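/- Let n ≥ 2 and let ν = (ν_1,…,ν_n) ∈ ℂ^n be regular. Then (i) for μ = (μ_1) ∈ ℂ¹ with q_1(m,μ) ≠ 0 for all integers m ≥ 1, one has c_{1,m}(μ) = 1/( m! (2μ_1+1)_m ) for every m ∈ ℕ; and (ii) for every m = (m_1,…,m_n) ∈ ℕ^n, c_{n,(m_1,…,m_n)}(ν) = Σ c_{n−1,(k_1,…,k_{n−1})}(ν̃) / [ ∏_{i=1}^{n−1} (m_i−l_i)! · (m_n−k_{n−1})! · ∏_{i=1}^{n−1} (l_i−k_i)! · ∏_{i=1}^{n} (ν_i+ν_n+1)_{m_i−l_{i−1}} · ∏_{i=1}^{n−1} (ν_i−ν_n+1)_{l_i−k_{i−1}} ], where the sum runs over integers l_1,…,l_{n−1} and k_1,…,k_{n−1} with 0 ≤ k_i ≤ l_i ≤ m_i for 1 ≤ i ≤ n−1 and 0 ≤ k_{n−1} ≤ m_n, with the convention k_0 = l_0 = 0. -/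

import Mathlib

noncomputable section

open MeasureTheory Finset

namespace SO

/-- Extend a `Fin n`-indexed real tuple to a `1`-based function on `ℕ` (default value `0`). -/
def extR (n : ℕ) (t : Fin n → ℝ) : ℕ → ℝ :=
  fun i => if h : 1 ≤ i ∧ i ≤ n then t ⟨i - 1, by omega⟩ else 0

/-- Extend a `Fin n`-indexed tuple of naturals to a `1`-based function on `ℕ` (default `0`). -/
def extN (n : ℕ) (t : Fin n → ℕ) : ℕ → ℕ :=
  fun i => if h : 1 ≤ i ∧ i ≤ n then t ⟨i - 1, by omega⟩ else 0

/-- The quadratic form `q_n(m, ν)`. -/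
def qB (n : ℕ) (m : ℕ → ℕ) (ν : ℕ → ℂ) : ℂ :=
  (∑ i ∈ Finset.Icc 1 (n - 1), ((m i : ℂ)) ^ 2) + (1 / 2) * (m n : ℂ) ^ 2
    - (∑ i ∈ Finset.Icc 1 (n - 1), (m i : ℂ) * (m (i + 1) : ℂ))
    + (∑ i ∈ Finset.Icc 1 (n - 1), (ν i - ν (i + 1)) * (m i : ℂ))
    + ν n * (m n : ℂ)

/-- Decrement the `i`-th coordinate by one. -/
def dec (m : ℕ → ℕ) (i : ℕ) : ℕ → ℕ := Function.update m i (m i - 1)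

/-- Auxiliary (fuel-indexed) recursion computing the coefficients `c_{n,m}(ν)`. -/
def cAux (n : ℕ) (ν : ℕ → ℂ) : ℕ → (ℕ → ℕ) → ℂ
  | 0, _ => 1
  | d + 1, m =>
      ((∑ i ∈ Finset.Icc 1 (n - 1), if m i = 0 then 0 else cAux n ν d (dec m i))
        + (1 / 2) * (if m n = 0 then 0 else cAux n ν d (dec m n))) / qB n m ν

/-- The coefficients `c_{n,m}(ν)`, determined by `c_{n,0} = 1` and the recurrence
`q_n(m,ν) c_{n,m}(ν) = ∑_{i=1}^{n-1} c_{n,m-e_i}(ν) + (1/2) c_{n,m-e_n}(ν)`. -/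
def cB (n : ℕ) (ν : ℕ → ℂ) (m : ℕ → ℕ) : ℂ :=
  cAux n ν (∑ i ∈ Finset.Icc 1 n, m i) m

/-- Pochhammer symbol `(a)_k = Γ(a+k)/Γ(a)` for `k ∈ ℤ`. -/
def poch (a : ℂ) (k : ℤ) : ℂ := Complex.Gamma (a + k) / Complex.Gamma a

/-- `z! ∈ ℂ` for `z ∈ ℤ`, with value `0` at negative integers (so that a factor `1/zfact z`
kills a summand containing the factorial of a negative integer). -/
def zfact (z : ℤ) : ℂ := if 0 ≤ z then (Nat.factorial z.toNat : ℂ) else 0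

/-- `Γ_n(ν) = ∏_{1≤i<j≤n} Γ(-ν_i-ν_j)Γ(-ν_i+ν_j) ∏_{i=1}^n Γ(-2ν_i)`. -/
def GammaN (n : ℕ) (ν : ℕ → ℂ) : ℂ :=
  (∏ i ∈ Finset.Icc 1 n, ∏ j ∈ Finset.Icc (i + 1) n,
      Complex.Gamma (-ν i - ν j) * Complex.Gamma (-ν i + ν j)) *
    ∏ i ∈ Finset.Icc 1 n, Complex.Gamma (-(2 * ν i))

/-- The Weyl group of type `B_n`: pairs of a permutation and a sign change. -/
abbrev SignedPerm (n : ℕ) := Equiv.Perm (Fin n) × (Fin n → Bool)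

/-- Action of a signed permutation on `ν ∈ ℂ^n` (1-based indexing). -/
def wAct (n : ℕ) (w : SignedPerm n) (ν : ℕ → ℂ) : ℕ → ℂ :=
  fun i =>
    if h : 1 ≤ i ∧ i ≤ n then
      (if w.2 ⟨i - 1, by omega⟩ then -1 else 1) * ν ((w.1 ⟨i - 1, by omega⟩ : Fin n).val + 1)
    else ν i

/-- Regularity of `ν ∈ ℂ^n`. -/
def Regular (n : ℕ) (ν : ℕ → ℂ) : Prop :=
  (∀ w : SignedPerm n, ∀ m : ℕ → ℕ,
      0 < ∑ i ∈ Finset.Icc 1 n, m i → qB n m (wAct n w ν) ≠ 0) ∧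
    ∀ w w' : SignedPerm n, w ≠ w' →
      ¬ ∀ i ∈ Finset.Icc 1 n, ∃ k : ℤ, wAct n w ν i - wAct n w' ν i = (k : ℂ)

/-- The fundamental Whittaker power series `M̃^n_ν(y)`. -/
def Mt (n : ℕ) (ν : ℕ → ℂ) (y : ℕ → ℝ) : ℂ :=
  ∑' m : Fin n → ℕ,
    cB n ν (extN n m) *
      ∏ i ∈ Finset.Icc 1 n,
        ((Real.pi * y i : ℝ) : ℂ) ^ (2 * ((extN n m i : ℂ) + ∑ j ∈ Finset.Icc 1 i, ν j))

/-- The modified Bessel function `K_s(z)` (for `Re z > 0`). -/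
def besselK (s z : ℂ) : ℂ :=
  (1 / 2) * ∫ t in Set.Ioi (0 : ℝ),
    Complex.exp (-(z / 2) * ((t : ℂ) + 1 / (t : ℂ))) * (t : ℂ) ^ s / (t : ℂ)

/-- The positive orthant in `(ℝ)^n`. -/
def posSet (n : ℕ) : Set (Fin n → ℝ) := {t | ∀ i, 0 < t i}

/-- The integrand in the recursive definition of `W̃^N_ν(y)`; `W` stands for `W̃^{N-1}_ν̃`. -/
def WtKernel (N : ℕ) (ν : ℕ → ℂ) (y : ℕ → ℝ) (W : (ℕ → ℝ) → ℂ)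
    (t : Fin N → ℝ) (u : Fin (N - 1) → ℝ) : ℂ :=
  ((∏ i ∈ Finset.Icc 1 N,
      Real.exp (-(Real.pi * y i) ^ 2 * extR N t i - 1 / extR N t i) : ℝ) : ℂ) *
    (∏ i ∈ Finset.Icc 1 N, ((Real.pi * y i : ℝ) : ℂ) ^ (2 * ν N)) *
    ((∏ i ∈ Finset.Icc 1 (N - 1),
        Real.exp (-(Real.pi * y i) ^ 2 * (extR N t i / extR N t (i + 1)) * extR (N - 1) u i
          - 1 / extR (N - 1) u i) : ℝ) : ℂ) *
    ((extR N t 1 : ℝ) : ℂ) ^ (2 * ν N) *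
    (∏ i ∈ Finset.Icc 1 (N - 1),
      ((extR N t (i + 1) * extR (N - 1) u i : ℝ) : ℂ) ^ (ν N)) *
    W (fun j => if j = N - 1 then y N * Real.sqrt (extR N t N / extR (N - 1) u (N - 1))
        else y (j + 1) * Real.sqrt (extR N t (j + 1) * extR (N - 1) u (j + 1) /
          (extR N t (j + 2) * extR (N - 1) u j))) *
    (((∏ i ∈ Finset.Icc 1 (N - 1), extR (N - 1) u i)⁻¹ : ℝ) : ℂ) *
    (((∏ i ∈ Finset.Icc 1 N, extR N t i)⁻¹ : ℝ) : ℂ)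

/-- The class one Whittaker function `W̃^n_ν(y)`, defined recursively. -/
def Wt : ℕ → (ℕ → ℂ) → (ℕ → ℝ) → ℂ
  | 0, _, _ => 0
  | 1, ν, y => 2 * besselK (2 * ν 1) (2 * Real.pi * y 1)
  | n + 2, ν, y =>
      ∫ t in posSet (n + 2), ∫ u in posSet (n + 1),
        WtKernel (n + 2) ν y (fun z => Wt (n + 1) ν z) t u

/-- The auxiliary function `V_ν(x)`. -/
def Vnu (n : ℕ) (ν : ℕ → ℂ) (x : ℕ → ℝ) : ℂ :=
  ∫ u in posSet (n - 1),
    ((∏ i ∈ Finset.Icc 1 (n - 1),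
        Real.exp (-(Real.pi * x i) ^ 2 * extR (n - 1) u i - 1 / extR (n - 1) u i) : ℝ) : ℂ) *
      (∏ i ∈ Finset.Icc 1 n, ((Real.pi * x i : ℝ) : ℂ) ^ (2 * ν n)) *
      (∏ i ∈ Finset.Icc 1 (n - 1), ((extR (n - 1) u i : ℝ) : ℂ) ^ (ν n)) *
      Wt (n - 1) ν (fun j => if j = n - 1 then x n * Real.sqrt (1 / extR (n - 1) u (n - 1))
          else x (j + 1) * Real.sqrt (extR (n - 1) u (j + 1) / extR (n - 1) u j)) *
      (((∏ i ∈ Finset.Icc 1 (n - 1), extR (n - 1) u i)⁻¹ : ℝ) : ℂ)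

/-- The coefficients `b_l(ν)` (zero unless all `l_i ≥ 0` and `l_{n-1} ≥ l_n`). -/
def bB (n : ℕ) (ν : ℕ → ℂ) (l : ℕ → ℤ) : ℂ :=
  if (∀ i ∈ Finset.Icc 1 n, 0 ≤ l i) ∧ l n ≤ l (n - 1) then
    (-1 : ℂ) ^ (l n) *
      ∑' k : Fin (n - 2) → ℕ,
        cB (n - 1) ν (fun i => if i = n - 1 then (l n).toNat else extN (n - 2) k i) /
          ((∏ i ∈ Finset.Icc 1 (n - 2), zfact (l i - (extN (n - 2) k i : ℤ))) *
            zfact (l (n - 1) - l n) *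
            ∏ i ∈ Finset.Icc 1 (n - 1),
              poch (ν i - ν n + 1) (l i - (extN (n - 2) k (i - 1) : ℤ)))
  else 0

/-- The coefficients `b^P_l(ν)` (zero unless all `l_i ≥ 0` and `l_{n-1} ≥ l_n`). -/
def bP (n : ℕ) (P : Finset ℕ) (ν : ℕ → ℂ) (l : ℕ → ℤ) : ℂ :=
  if (∀ i ∈ Finset.Icc 1 n, 0 ≤ l i) ∧ l n ≤ l (n - 1) then
    (-1 : ℂ) ^ (l n) *
      ∑' k : Fin (n - 2) → ℕ,
        cB (n - 1) ν (fun i => if i = n - 1 then (l n).toNat else extN (n - 2) k i) /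
          ((∏ i ∈ (Finset.Icc 1 (n - 2)).filter (· ∈ P),
              zfact (l i - (extN (n - 2) k i : ℤ)) *
                poch (ν i - ν n + 1) (l i - (extN (n - 2) k (i - 1) : ℤ))) *
            (∏ i ∈ (Finset.Icc 1 (n - 2)).filter (· ∉ P),
              zfact (l i - (extN (n - 2) k (i - 1) : ℤ)) *
                poch (-ν i + ν n + 1) (l i - (extN (n - 2) k i : ℤ))) *
            (if n - 1 ∈ P then
                zfact (l (n - 1) - l n) *
                  poch (ν (n - 1) - ν n + 1) (l (n - 1) - (extN (n - 2) k (n - 2) : ℤ))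
              else
                zfact (l (n - 1) - (extN (n - 2) k (n - 2) : ℤ)) *
                  poch (-ν (n - 1) + ν n + 1) (l (n - 1) - l n)))
  else 0

/-- `ν^{(p)} = (ν_1, …, ν_{p-1}, ν_n, ν_p, …, ν_{n-1})`. -/
def nuP (n p : ℕ) (ν : ℕ → ℂ) : ℕ → ℂ :=
  fun i => if i < p then ν i else if i = p then ν n else ν (i - 1)

/-- `ν̄^{(q)} = (ν_1, …, ν_{q-1}, -ν_n, ν_q, …, ν_{n-1})`. -/
def nuBar (n q : ℕ) (ν : ℕ → ℂ) : ℕ → ℂ :=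
  fun i => if i < q then ν i else if i = q then -ν n else ν (i - 1)

/-- `Γ^P(ν)`. -/
def GammaP (n : ℕ) (P : Finset ℕ) (ν : ℕ → ℂ) : ℂ :=
  GammaN (n - 1) ν *
    (∏ i ∈ (Finset.Icc 1 (n - 1)).filter (· ∈ P), Complex.Gamma (-ν i + ν n)) *
    ∏ i ∈ (Finset.Icc 1 (n - 1)).filter (· ∉ P), Complex.Gamma (ν i - ν n)

/-- `Γ^p(ν) = Γ^P(ν)` with `P = {1, …, p-1}`. -/
def Gammap (n p : ℕ) (ν : ℕ → ℂ) : ℂ := GammaP n (Finset.Icc 1 (p - 1)) ν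

/-- `b^p_l(ν) = b^P_l(ν)` with `P = {1, …, p-1}`. -/
def bp (n p : ℕ) (ν : ℕ → ℂ) (l : ℕ → ℤ) : ℂ := bP n (Finset.Icc 1 (p - 1)) ν l

/-- `Γ^{p,Q}(ν)`. -/
def GammaPQ (n p : ℕ) (Q : Finset ℕ) (ν : ℕ → ℂ) : ℂ :=
  Gammap n p ν *
    (∏ i ∈ (Finset.Icc 1 n).filter (· ∈ Q), Complex.Gamma (-(nuP n p ν i) - ν n)) *
    ∏ i ∈ (Finset.Icc 1 n).filter (· ∉ Q), Complex.Gamma (nuP n p ν i + ν n)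

/-- The coefficients `c^{p,Q}_m(ν)` (zero if some `m_i < 0`). -/
def cPQ (n p : ℕ) (Q : Finset ℕ) (ν : ℕ → ℂ) (m : ℕ → ℤ) : ℂ :=
  if ∀ i ∈ Finset.Icc 1 n, 0 ≤ m i then
    ∑' l : Fin n → ℕ,
      (-1 : ℂ) ^ ((extN n l n : ℤ)) * bp n p ν (fun i => (extN n l i : ℤ)) /
        ((∏ i ∈ (Finset.Icc 1 n).filter (· ∈ Q),
            zfact (m i - (extN n l i : ℤ)) *
              poch (nuP n p ν i + ν n + 1) (m i - (extN n l (i - 1) : ℤ))) *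
          ∏ i ∈ (Finset.Icc 1 n).filter (· ∉ Q),
            zfact (m i - (extN n l (i - 1) : ℤ)) *
              poch (-(nuP n p ν i) - ν n + 1) (m i - (extN n l i : ℤ)))
  else 0

/-- The power series `M̃^{p,Q}_ν(y)`. -/
def MPQ (n p : ℕ) (Q : Finset ℕ) (ν : ℕ → ℂ) (y : ℕ → ℝ) : ℂ :=
  ∑' m : Fin n → ℕ,
    cPQ n p Q ν (fun i => (extN n m i : ℤ)) *
      (∏ i ∈ (Finset.Icc 1 n).filter (· ∈ Q),
        ((Real.pi * y i : ℝ) : ℂ) ^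
          (2 * ((extN n m i : ℂ) + ∑ j ∈ Finset.Icc 1 i, nuP n p ν j))) *
      ∏ i ∈ (Finset.Icc 1 n).filter (· ∉ Q),
        ((Real.pi * y i : ℝ) : ℂ) ^
          (2 * ((extN n m i : ℂ) + ∑ j ∈ Finset.Icc 1 (i - 1), nuP n p ν j - ν n))

/-- The Mellin-transform integrand. -/
def Tintegrand (n : ℕ) (ν : ℕ → ℂ) (s : ℕ → ℂ) (y : Fin n → ℝ) : ℂ :=
  Wt n ν (extR n y) *
    (∏ i ∈ Finset.Icc 1 n, ((Real.pi * extR n y i : ℝ) : ℂ) ^ (2 * s i)) *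
    (((∏ i ∈ Finset.Icc 1 n, extR n y i)⁻¹ : ℝ) : ℂ)

/-- The multiple Mellin transform `T^n_ν(s)` of the class one Whittaker function. -/
def Tn (n : ℕ) (ν : ℕ → ℂ) (s : ℕ → ℂ) : ℂ := ∫ y in posSet n, Tintegrand n ν s y


/-! ### Auxiliary material for the proof -/

/-- reciprocal factorial on the integers -/
def rf (z : ℤ) : ℂ := (zfact z)⁻¹

/-- reciprocal Pochhammer symbol -/
def rp (a : ℂ) (z : ℤ) : ℂ := (poch a z)⁻¹

lemma rf_neg {z : ℤ} (h : z < 0) : rf z = 0 := by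
  simp [rf, zfact, not_le.mpr h]

lemma rf_step (z : ℤ) : (z : ℂ) * rf z = rf (z - 1) := by
  rcases lt_trichotomy z 0 with h | h | h
  · rw [rf_neg h, rf_neg (by omega), mul_zero]
  · subst h; rw [rf_neg (z := 0 - 1) (by omega)]; simp
  · obtain ⟨k, rfl⟩ : ∃ k : ℕ, z = (k : ℤ) + 1 := ⟨(z - 1).toNat, by omega⟩
    have h1 : ((k : ℤ) + 1).toNat = k + 1 := by omega
    have h2 : (0 : ℤ) ≤ (k : ℤ) + 1 := by omega
    have h3 : ((k : ℂ) + 1) ≠ 0 := by exact_mod_cast Nat.succ_ne_zero k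
    have h4 : ((k.factorial : ℕ) : ℂ) ≠ 0 := by exact_mod_cast Nat.factorial_ne_zero k
    simp only [rf, zfact, h1, h2, add_sub_cancel_right, if_true, Int.natCast_nonneg,
      Int.toNat_natCast, Nat.factorial_succ]
    push_cast
    field_simp

lemma rf_zero : rf 0 = 1 := by simp [rf, zfact]

lemma rp_step (b : ℂ) (hb : ∀ z : ℤ, b ≠ z) (z : ℤ) :
    (b + z) * rp (b + 1) z = rp (b + 1) (z - 1) := by
  have h0 : b + z ≠ 0 := by
    intro h
    apply hb (-z)
    push_cast
    linear_combination h
  have e : b + 1 + (z : ℂ) = (b + z) + 1 := by ring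
  have e2 : b + 1 + ((z - 1 : ℤ) : ℂ) = b + z := by push_cast; ring
  rw [rp, rp, poch, poch, e, e2, Complex.Gamma_add_one _ h0, inv_div, inv_div,
    ← mul_div_assoc, mul_div_mul_left _ _ h0]

lemma rp_zero (b : ℂ) (hb : ∀ z : ℤ, b ≠ z) : rp (b + 1) 0 = 1 := by
  have : Complex.Gamma (b + 1) ≠ 0 := by
    apply Complex.Gamma_ne_zero
    intro m h
    apply hb (-m - 1)
    push_cast
    linear_combination h
  simp [rp, poch, this]

lemma prod_change {s : Finset ℕ} {i : ℕ} (hi : i ∈ s) {f g : ℕ → ℂ} {c : ℂ}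
    (h : ∀ j ∈ s, j ≠ i → f j = g j) (hc : c * f i = g i) :
    c * ∏ j ∈ s, f j = ∏ j ∈ s, g j := by
  rw [← Finset.mul_prod_erase s f hi, ← Finset.mul_prod_erase s g hi, ← mul_assoc, hc]
  congr 1
  apply Finset.prod_congr rfl
  intro j hj
  exact h j (Finset.mem_of_mem_erase hj) (Finset.ne_of_mem_erase hj)

/-- unit vector -/
def un (i : ℕ) : ℕ → ℤ := Pi.single i 1

lemma un_self (i : ℕ) : un i i = 1 := by simp [un]
lemma un_ne {i j : ℕ} (h : j ≠ i) : un i j = 0 := by simp [un, h]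

/-- The kernel. -/
def TT (M : ℕ) (ν : ℕ → ℂ) (m l k : ℕ → ℤ) : ℂ :=
  (∏ i ∈ Finset.Icc 1 (M + 1), rf (m i - l i)) * rf (m (M + 2) - k (M + 1)) *
    (∏ i ∈ Finset.Icc 1 (M + 1), rf (l i - k i)) *
    (∏ i ∈ Finset.Icc 1 (M + 2), rp (ν i + ν (M + 2) + 1) (m i - l (i - 1))) *
    ∏ i ∈ Finset.Icc 1 (M + 1), rp (ν i - ν (M + 2) + 1) (l i - k (i - 1))

lemma TT_m {M : ℕ} {ν : ℕ → ℂ}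
    (h1 : ∀ i ∈ Finset.Icc 1 (M + 2), ∀ z : ℤ, ν i + ν (M + 2) ≠ z)
    {i : ℕ} (hi : i ∈ Finset.Icc 1 (M + 1)) (m l k : ℕ → ℤ) :
    TT M ν (m - un i) l k =
      ((m i : ℂ) - l i) * (ν i + ν (M + 2) + m i - l (i - 1)) * TT M ν m l k := by
  have hi' := Finset.mem_Icc.mp hi
  have hi2 : i ∈ Finset.Icc 1 (M + 2) := Finset.mem_Icc.mpr ⟨hi'.1, by omega⟩
  have a1 : ((m i : ℂ) - l i) * ∏ j ∈ Finset.Icc 1 (M + 1), rf (m j - l j) =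
      ∏ j ∈ Finset.Icc 1 (M + 1), rf ((m - un i) j - l j) := by
    apply prod_change hi
    · intro j _ hj; simp [un_ne hj]
    · have := rf_step (m i - l i)
      push_cast at this
      rw [this, Pi.sub_apply, un_self]; congr 1; ring
  have a2 : (ν i + ν (M + 2) + m i - l (i - 1)) *
      ∏ j ∈ Finset.Icc 1 (M + 2), rp (ν j + ν (M + 2) + 1) (m j - l (j - 1)) =
      ∏ j ∈ Finset.Icc 1 (M + 2), rp (ν j + ν (M + 2) + 1) ((m - un i) j - l (j - 1)) := by
    apply prod_change hi2
    · intro j _ hj; simp [un_ne hj]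
    · have := rp_step _ (h1 i hi2) (m i - l (i - 1))
      push_cast at this
      rw [add_sub_assoc, this, Pi.sub_apply, un_self]; congr 1; ring
  have a3 : (m - un i) (M + 2) = m (M + 2) := by
    simp [un_ne (show M + 2 ≠ i by omega)]
  unfold TT
  rw [← a1, ← a2, a3]; ring

lemma TT_mn {M : ℕ} {ν : ℕ → ℂ}
    (h1 : ∀ i ∈ Finset.Icc 1 (M + 2), ∀ z : ℤ, ν i + ν (M + 2) ≠ z)
    (m l k : ℕ → ℤ) :
    TT M ν (m - un (M + 2)) l k =
      ((m (M + 2) : ℂ) - k (M + 1)) * (ν (M + 2) + ν (M + 2) + m (M + 2) - l (M + 1))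
        * TT M ν m l k := by
  have hi2 : M + 2 ∈ Finset.Icc 1 (M + 2) := Finset.mem_Icc.mpr ⟨by omega, by omega⟩
  have a1 : ∏ j ∈ Finset.Icc 1 (M + 1), rf (m j - l j) =
      ∏ j ∈ Finset.Icc 1 (M + 1), rf ((m - un (M + 2)) j - l j) := by
    apply Finset.prod_congr rfl
    intro j hj
    have := Finset.mem_Icc.mp hj
    simp [un_ne (show j ≠ M + 2 by omega)]
  have a2 : (ν (M + 2) + ν (M + 2) + m (M + 2) - l (M + 1)) *
      ∏ j ∈ Finset.Icc 1 (M + 2), rp (ν j + ν (M + 2) + 1) (m j - l (j - 1)) =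
      ∏ j ∈ Finset.Icc 1 (M + 2), rp (ν j + ν (M + 2) + 1)
        ((m - un (M + 2)) j - l (j - 1)) := by
    apply prod_change hi2
    · intro j _ hj; simp [un_ne hj]
    · have := rp_step _ (h1 _ hi2) (m (M + 2) - l (M + 2 - 1))
      push_cast at this
      rw [add_sub_assoc]
      simp only [show M + 2 - 1 = M + 1 by omega] at this ⊢
      rw [this, Pi.sub_apply, un_self]; congr 1; ring
  have a3 : ((m (M + 2) : ℂ) - k (M + 1)) * rf (m (M + 2) - k (M + 1)) =
      rf ((m - un (M + 2)) (M + 2) - k (M + 1)) := by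
    have := rf_step (m (M + 2) - k (M + 1))
    push_cast at this
    rw [this, Pi.sub_apply, un_self]; congr 1; ring
  unfold TT
  rw [← a1, ← a2, ← a3]; ring

lemma TT_l {M : ℕ} {ν : ℕ → ℂ}
    (h1 : ∀ i ∈ Finset.Icc 1 (M + 2), ∀ z : ℤ, ν i + ν (M + 2) ≠ z)
    (h2 : ∀ i ∈ Finset.Icc 1 (M + 1), ∀ z : ℤ, ν i - ν (M + 2) ≠ z)
    {i : ℕ} (hi : i ∈ Finset.Icc 1 (M + 1)) (m l k : ℕ → ℤ) :
    ((m i : ℂ) - l i) * (ν (i + 1) + ν (M + 2) + m (i + 1) - l i) * TT M ν m l k =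
    (((l + un i) i : ℤ) - (k i : ℂ)) * (ν i - ν (M + 2) + ((l + un i) i : ℤ) - k (i - 1)) *
      TT M ν m (l + un i) k := by
  have hi' := Finset.mem_Icc.mp hi
  have hi2 : i + 1 ∈ Finset.Icc 1 (M + 2) := Finset.mem_Icc.mpr ⟨by omega, by omega⟩
  have a1 : ((m i : ℂ) - l i) * ∏ j ∈ Finset.Icc 1 (M + 1), rf (m j - l j) =
      ∏ j ∈ Finset.Icc 1 (M + 1), rf (m j - (l + un i) j) := by
    apply prod_change hi
    · intro j _ hj; simp [un_ne hj]
    · have := rf_step (m i - l i)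
      push_cast at this
      rw [this, Pi.add_apply, un_self]; congr 1; ring
  have a2 : (ν (i + 1) + ν (M + 2) + m (i + 1) - l i) *
      ∏ j ∈ Finset.Icc 1 (M + 2), rp (ν j + ν (M + 2) + 1) (m j - l (j - 1)) =
      ∏ j ∈ Finset.Icc 1 (M + 2), rp (ν j + ν (M + 2) + 1) (m j - (l + un i) (j - 1)) := by
    apply prod_change hi2
    · intro j hj hj'
      have := Finset.mem_Icc.mp hj
      simp [un_ne (show j - 1 ≠ i by omega)]
    · have := rp_step _ (h1 _ hi2) (m (i + 1) - l (i + 1 - 1))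
      simp only [Nat.add_sub_cancel] at this ⊢
      push_cast at this
      rw [add_sub_assoc, this, Pi.add_apply, un_self]; congr 1; ring
  have a3 : ((((l + un i) i : ℤ) : ℂ) - (k i : ℂ)) *
      ∏ j ∈ Finset.Icc 1 (M + 1), rf ((l + un i) j - k j) =
      ∏ j ∈ Finset.Icc 1 (M + 1), rf (l j - k j) := by
    apply prod_change hi
    · intro j _ hj; simp [un_ne hj]
    · have := rf_step ((l + un i) i - k i)
      push_cast at this
      rw [this, Pi.add_apply, un_self]; congr 1; ring
  have a4 : (ν i - ν (M + 2) + ((l + un i) i : ℤ) - k (i - 1)) *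
      ∏ j ∈ Finset.Icc 1 (M + 1), rp (ν j - ν (M + 2) + 1) ((l + un i) j - k (j - 1)) =
      ∏ j ∈ Finset.Icc 1 (M + 1), rp (ν j - ν (M + 2) + 1) (l j - k (j - 1)) := by
    apply prod_change hi
    · intro j _ hj; simp [un_ne hj]
    · have := rp_step _ (h2 _ hi) ((l + un i) i - k (i - 1))
      push_cast at this
      rw [add_sub_assoc, this, Pi.add_apply, un_self]; congr 1; ring
  unfold TT
  rw [← a1, ← a2, ← a3, ← a4]; ring

lemma TT_k {M : ℕ} {ν : ℕ → ℂ}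
    (h2 : ∀ i ∈ Finset.Icc 1 (M + 1), ∀ z : ℤ, ν i - ν (M + 2) ≠ z)
    {i : ℕ} (hi : i ∈ Finset.Icc 1 M) (m l k : ℕ → ℤ) :
    TT M ν m l (k + un i) =
      ((l i : ℂ) - k i) * (ν (i + 1) - ν (M + 2) + l (i + 1) - k i) * TT M ν m l k := by
  have hi' := Finset.mem_Icc.mp hi
  have hi1 : i ∈ Finset.Icc 1 (M + 1) := Finset.mem_Icc.mpr ⟨by omega, by omega⟩
  have hi2 : i + 1 ∈ Finset.Icc 1 (M + 1) := Finset.mem_Icc.mpr ⟨by omega, by omega⟩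
  have a1 : ((l i : ℂ) - k i) * ∏ j ∈ Finset.Icc 1 (M + 1), rf (l j - k j) =
      ∏ j ∈ Finset.Icc 1 (M + 1), rf (l j - (k + un i) j) := by
    apply prod_change hi1
    · intro j _ hj; simp [un_ne hj]
    · have := rf_step (l i - k i)
      push_cast at this
      rw [this, Pi.add_apply, un_self]; congr 1; ring
  have a2 : (ν (i + 1) - ν (M + 2) + l (i + 1) - k i) *
      ∏ j ∈ Finset.Icc 1 (M + 1), rp (ν j - ν (M + 2) + 1) (l j - k (j - 1)) =
      ∏ j ∈ Finset.Icc 1 (M + 1), rp (ν j - ν (M + 2) + 1) (l j - (k + un i) (j - 1)) := by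
    apply prod_change hi2
    · intro j hj hj'
      have := Finset.mem_Icc.mp hj
      simp [un_ne (show j - 1 ≠ i by omega)]
    · have := rp_step _ (h2 _ hi2) (l (i + 1) - k (i + 1 - 1))
      simp only [Nat.add_sub_cancel] at this ⊢
      push_cast at this
      rw [add_sub_assoc, this, Pi.add_apply, un_self]; congr 1; ring
  have a3 : (k + un i) (M + 1) = k (M + 1) := by
    simp [un_ne (show M + 1 ≠ i by omega)]
  unfold TT
  rw [← a1, ← a2, a3]; ring

lemma TT_kN {M : ℕ} {ν : ℕ → ℂ} (m l k : ℕ → ℤ) :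
    TT M ν m l (k + un (M + 1)) =
      ((m (M + 2) : ℂ) - k (M + 1)) * ((l (M + 1) : ℂ) - k (M + 1)) * TT M ν m l k := by
  have hi1 : M + 1 ∈ Finset.Icc 1 (M + 1) := Finset.mem_Icc.mpr ⟨by omega, by omega⟩
  have a1 : ((l (M + 1) : ℂ) - k (M + 1)) * ∏ j ∈ Finset.Icc 1 (M + 1), rf (l j - k j) =
      ∏ j ∈ Finset.Icc 1 (M + 1), rf (l j - (k + un (M + 1)) j) := by
    apply prod_change hi1
    · intro j _ hj; simp [un_ne hj]
    · have := rf_step (l (M + 1) - k (M + 1))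
      push_cast at this
      rw [this, Pi.add_apply, un_self]; congr 1; ring
  have a2 : ∏ j ∈ Finset.Icc 1 (M + 1), rp (ν j - ν (M + 2) + 1) (l j - k (j - 1)) =
      ∏ j ∈ Finset.Icc 1 (M + 1), rp (ν j - ν (M + 2) + 1)
        (l j - (k + un (M + 1)) (j - 1)) := by
    apply Finset.prod_congr rfl
    intro j hj
    have := Finset.mem_Icc.mp hj
    simp [un_ne (show j - 1 ≠ M + 1 by omega)]
  have a3 : ((m (M + 2) : ℂ) - k (M + 1)) * rf (m (M + 2) - k (M + 1)) =
      rf (m (M + 2) - (k + un (M + 1)) (M + 1)) := by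
    have := rf_step (m (M + 2) - k (M + 1))
    push_cast at this
    rw [this, Pi.add_apply, un_self]; congr 1; ring
  unfold TT
  rw [← a1, ← a2, ← a3]; ring

/-- the quadratic form with complex entries -/
def qC (n : ℕ) (m : ℕ → ℂ) (ν : ℕ → ℂ) : ℂ :=
  (∑ i ∈ Finset.Icc 1 (n - 1), (m i) ^ 2) + (1 / 2) * (m n) ^ 2
    - (∑ i ∈ Finset.Icc 1 (n - 1), m i * m (i + 1))
    + (∑ i ∈ Finset.Icc 1 (n - 1), (ν i - ν (i + 1)) * m i)
    + ν n * m n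

lemma poly_aux (M : ℕ) (a : ℂ) (ν m l k : ℕ → ℂ) (hl : l 0 = 0) (hk : k 0 = 0) :
    ∑ i ∈ Finset.Icc 1 M, (m i ^ 2 - m i * m (i + 1) + (ν i - ν (i + 1)) * m i
      - (m i - l i) * (ν i + a + m i - l (i - 1))
      + (m i - l i) * (ν (i + 1) + a + m (i + 1) - l i)
      - (l i - k i) * (ν i - a + l i - k (i - 1))
      + (l i - k i) * (ν (i + 1) - a + l (i + 1) - k i)
      - (k i ^ 2 - k i * k (i + 1) + (ν i - ν (i + 1)) * k i)) =
    - l M * m (M + 1) + l M * l (M + 1) - k M * l (M + 1) + k M * k (M + 1) := by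
  induction M with
  | zero => simp [hl, hk]
  | succ M ih =>
    rw [Finset.sum_Icc_succ_top (by omega), ih]
    simp only [Nat.add_sub_cancel]
    ring

lemma poly_id (M : ℕ) (ν m l k : ℕ → ℂ) (hl : l 0 = 0) (hk : k 0 = 0) :
    qC (M + 2) m ν
      - ∑ i ∈ Finset.Icc 1 (M + 1), (m i - l i) * (ν i + ν (M + 2) + m i - l (i - 1))
      - (1 / 2) * ((m (M + 2) - k (M + 1)) * (ν (M + 2) + ν (M + 2) + m (M + 2) - l (M + 1)))
      + ∑ i ∈ Finset.Icc 1 (M + 1), (m i - l i) * (ν (i + 1) + ν (M + 2) + m (i + 1) - l i)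
      - ∑ i ∈ Finset.Icc 1 (M + 1), (l i - k i) * (ν i - ν (M + 2) + l i - k (i - 1))
      + ∑ i ∈ Finset.Icc 1 M, (l i - k i) * (ν (i + 1) - ν (M + 2) + l (i + 1) - k i)
      + (1 / 2) * ((m (M + 2) - k (M + 1)) * (l (M + 1) - k (M + 1)))
      - qC (M + 1) k ν = 0 := by
  have := poly_aux M (ν (M + 2)) ν m l k hl hk
  simp only [Finset.sum_add_distrib, Finset.sum_sub_distrib] at this
  unfold qC
  simp only [show M + 2 - 1 = M + 1 by omega, Nat.add_sub_cancel,
    Finset.sum_Icc_succ_top (show 1 ≤ M + 1 by omega)]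
  linear_combination this

lemma dec_sum {n : ℕ} {m : ℕ → ℕ} {i : ℕ} (hi : i ∈ Finset.Icc 1 n) (h : m i ≠ 0) :
    ∑ j ∈ Finset.Icc 1 n, dec m i j + 1 = ∑ j ∈ Finset.Icc 1 n, m j := by
  rw [← Finset.add_sum_erase _ _ hi, ← Finset.add_sum_erase _ m hi]
  have : ∑ j ∈ (Finset.Icc 1 n).erase i, dec m i j = ∑ j ∈ (Finset.Icc 1 n).erase i, m j := by
    apply Finset.sum_congr rfl
    intro j hj
    simp [dec, Finset.ne_of_mem_erase hj]
  rw [this]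
  simp only [dec, Function.update_self]
  omega

lemma cB_rec (n : ℕ) (hn : 1 ≤ n) (ν : ℕ → ℂ) (m : ℕ → ℕ)
    (hm : 0 < ∑ i ∈ Finset.Icc 1 n, m i) (hq : qB n m ν ≠ 0) :
    qB n m ν * cB n ν m = (∑ i ∈ Finset.Icc 1 (n - 1), if m i = 0 then 0 else cB n ν (dec m i))
        + (1 / 2) * (if m n = 0 then 0 else cB n ν (dec m n)) := by
  have key : ∀ i ∈ Finset.Icc 1 n, m i ≠ 0 →
      cB n ν (dec m i) = cAux n ν (∑ i ∈ Finset.Icc 1 n, m i - 1) (dec m i) := by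
    intro i hi h
    have := dec_sum hi h
    rw [cB]; congr 1; omega
  obtain ⟨d, hd⟩ : ∃ d, ∑ i ∈ Finset.Icc 1 n, m i = d + 1 := ⟨_, (Nat.sub_add_cancel hm).symm⟩
  rw [cB, hd, cAux, mul_div_cancel₀ _ hq]
  rw [hd, Nat.add_sub_cancel] at key
  congr 1
  · apply Finset.sum_congr rfl
    intro i hi
    have := Finset.mem_Icc.mp hi
    split_ifs with h
    · rfl
    · rw [key i (Finset.mem_Icc.mpr ⟨this.1, by omega⟩) h]
  · split_ifs with h
    · rfl
    · rw [key n (Finset.mem_Icc.mpr ⟨hn, le_rfl⟩) h]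

/-- Extension of the coefficients by zero. -/
def CC (N : ℕ) (ν : ℕ → ℂ) (k : ℕ → ℤ) : ℂ :=
  open Classical in
  if ∀ i ∈ Finset.Icc 1 N, 0 ≤ k i then cB N ν (fun i => (k i).toNat) else 0

lemma CC_neg {N : ℕ} {ν : ℕ → ℂ} {k : ℕ → ℤ} {i : ℕ} (hi : i ∈ Finset.Icc 1 N)
    (h : k i < 0) : CC N ν k = 0 := by
  rw [CC, if_neg]
  intro h'
  have := h' i hi
  omega

lemma CC_dec {N : ℕ} {ν : ℕ → ℂ} {k : ℕ → ℤ} (hk : ∀ i ∈ Finset.Icc 1 N, 0 ≤ k i)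
    {i : ℕ} (hi : i ∈ Finset.Icc 1 N) : CC N ν (k - un i) =
      if (k i).toNat = 0 then 0 else cB N ν (dec (fun i => (k i).toNat) i) := by
  split_ifs with h
  · apply CC_neg hi
    rw [Pi.sub_apply, un_self]; have := hk i hi; omega
  · rw [CC, if_pos]
    · congr 1
      funext j
      by_cases hj : j = i
      · subst hj; simp only [Pi.sub_apply, un_self, dec, Function.update_self]; omega
      · simp [un_ne hj, dec, hj]
    · intro j hj
      by_cases hj' : j = i
      · subst hj'; simp only [Pi.sub_apply, un_self]; omega
      · simp [un_ne hj', hk j hj]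

lemma CC_rec (M : ℕ) (ν : ℕ → ℂ)
    (hq : ∀ m : ℕ → ℕ, 0 < ∑ i ∈ Finset.Icc 1 (M + 1), m i → qB (M + 1) m ν ≠ 0)
    (k : ℕ → ℤ) :
    qC (M + 1) (fun i => (k i : ℂ)) ν * CC (M + 1) ν k =
      (∑ i ∈ Finset.Icc 1 M, CC (M + 1) ν (k - un i)) + (1 / 2) * CC (M + 1) ν (k - un (M + 1)) := by
  have mem : ∀ i ∈ Finset.Icc 1 M, i ∈ Finset.Icc 1 (M + 1) := by
    intro i hi
    have := Finset.mem_Icc.mp hi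
    exact Finset.mem_Icc.mpr ⟨this.1, by omega⟩
  have memN : M + 1 ∈ Finset.Icc 1 (M + 1) := Finset.mem_Icc.mpr ⟨by omega, le_rfl⟩
  by_cases hk : ∀ i ∈ Finset.Icc 1 (M + 1), 0 ≤ k i
  · have e : qC (M + 1) (fun i => (k i : ℂ)) ν = qB (M + 1) (fun i => (k i).toNat) ν := by
      have hc : ∀ i ∈ Finset.Icc 1 (M + 1), (((k i).toNat : ℕ) : ℂ) = (k i : ℂ) := by
        intro i hi
        have h : (((k i).toNat : ℕ) : ℤ) = k i := Int.toNat_of_nonneg (hk i hi)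
        exact_mod_cast congrArg (fun z : ℤ => (z : ℂ)) h
      unfold qC qB
      simp only [Nat.add_sub_cancel]
      rw [hc _ memN]
      congr 2
      · congr 1
        · congr 1
          apply Finset.sum_congr rfl
          intro i hi; rw [hc i (mem i hi)]
        · apply Finset.sum_congr rfl
          intro i hi
          have := Finset.mem_Icc.mp hi
          rw [hc i (mem i hi), hc (i + 1) (Finset.mem_Icc.mpr ⟨by omega, by omega⟩)]
      · apply Finset.sum_congr rfl
        intro i hi; rw [hc i (mem i hi)]
    have e2 : CC (M + 1) ν k = cB (M + 1) ν (fun i => (k i).toNat) := by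
      rw [CC, if_pos hk]
    rw [e, e2, CC_dec hk memN, Finset.sum_congr rfl (fun i hi => CC_dec hk (mem i hi))]
    by_cases h0 : 0 < ∑ i ∈ Finset.Icc 1 (M + 1), (k i).toNat
    · rw [cB_rec (M + 1) (by omega) ν _ h0 (hq _ h0)]
      simp only [Nat.add_sub_cancel]
    · have hz : ∀ i ∈ Finset.Icc 1 (M + 1), (k i).toNat = 0 := by
        intro i hi
        have := Finset.single_le_sum (f := fun i => (k i).toNat) (fun _ _ => Nat.zero_le _) hi
        omega
      rw [if_pos (hz _ memN), Finset.sum_eq_zero (fun i hi => if_pos (hz i (mem i hi)))]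
      unfold qB
      simp only [Nat.add_sub_cancel]
      rw [hz _ memN]
      rw [Finset.sum_eq_zero, Finset.sum_eq_zero, Finset.sum_eq_zero]
      · simp
      all_goals
        intro i hi
        rw [hz i (mem i hi)]
        simp
  · have hk' := hk
    push Not at hk'
    obtain ⟨j, hj, hj'⟩ := hk'
    have : ∀ i, CC (M + 1) ν (k - un i) = 0 := by
      intro i
      apply CC_neg hj
      rw [Pi.sub_apply]
      have : 0 ≤ un i j := by
        by_cases h : j = i
        · subst h; simp [un_self]
        · simp [un_ne h]
      omega
    rw [CC_neg hj hj']
    simp [this]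

/-- extension of integer tuples -/
def ex (n : ℕ) (t : Fin n → ℤ) : ℕ → ℤ :=
  fun i => if h : 1 ≤ i ∧ i ≤ n then t ⟨i - 1, by omega⟩ else 0

lemma ex_zero (n : ℕ) (t : Fin n → ℤ) : ex n t 0 = 0 := by simp [ex]

/-- unit vector in the finite index set -/
def fu (n i : ℕ) : Fin n → ℤ := fun j => if j.val + 1 = i then 1 else 0

lemma ex_add {n i : ℕ} (hi : i ∈ Finset.Icc 1 n) (t : Fin n → ℤ) :
    ex n (t + fu n i) = ex n t + un i := by
  have := Finset.mem_Icc.mp hi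
  funext j
  by_cases h : 1 ≤ j ∧ j ≤ n
  · by_cases hj : j = i
    · subst hj
      simp [ex, h, fu, un_self]
    · have : j - 1 + 1 ≠ i := by omega
      rw [Pi.add_apply, un_ne hj]
      simp only [ex, dif_pos h, fu, Pi.add_apply, if_neg this]
  · have hj : j ≠ i := by rintro rfl; exact h this
    simp [ex, h, un_ne hj]

lemma ex_apply (n : ℕ) (t : Fin n → ℤ) (j : Fin n) : ex n t (j.val + 1) = t j := by
  have : j.val + 1 ≤ n := j.isLt
  simp [ex, this]

abbrev EE (M : ℕ) := (Fin (M + 1) → ℤ) × (Fin (M + 1) → ℤ)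

/-- shift in the first component -/
def sh1 (M i : ℕ) : EE M ≃ EE M := Equiv.addRight ((fu (M + 1) i, 0) : EE M)
/-- shift in the second component -/
def sh2 (M i : ℕ) : EE M ≃ EE M := Equiv.addRight ((0, fu (M + 1) i) : EE M)

/-- The summand. -/
def FF (M : ℕ) (ν : ℕ → ℂ) (m : ℕ → ℤ) (p : EE M) : ℂ :=
  CC (M + 1) ν (ex _ p.2) * TT M ν m (ex _ p.1) (ex _ p.2)

lemma FF_supp {M : ℕ} {ν : ℕ → ℂ} {m : ℕ → ℤ} {p : EE M} (h : FF M ν m p ≠ 0) :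
    (∀ i ∈ Finset.Icc 1 (M + 1), 0 ≤ ex _ p.2 i ∧ ex _ p.2 i ≤ ex _ p.1 i ∧ ex _ p.1 i ≤ m i) ∧
      ex _ p.2 (M + 1) ≤ m (M + 2) := by
  unfold FF TT at h
  simp only [mul_ne_zero_iff, Finset.prod_ne_zero_iff] at h
  obtain ⟨hc, ⟨⟨⟨ha, hb⟩, hd⟩, -⟩, -⟩ := h
  have rfn : ∀ z, rf z ≠ 0 → 0 ≤ z := by
    intro z hz
    by_contra h
    exact hz (rf_neg (by omega))
  refine ⟨fun i hi => ⟨?_, ?_, ?_⟩, ?_⟩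
  · by_contra hh
    exact hc (CC_neg hi (by omega))
  · have := rfn _ (hd i hi); omega
  · have := rfn _ (ha i hi); omega
  · have := rfn _ hb; omega

lemma FF_fin (M : ℕ) (ν : ℕ → ℂ) (m : ℕ → ℤ) : (Function.support (FF M ν m)).Finite := by
  apply Set.Finite.subset ((Set.finite_Icc (0 : Fin (M + 1) → ℤ)
    (fun i => m (i.val + 1))).prod (Set.finite_Icc (0 : Fin (M + 1) → ℤ)
    (fun i => m (i.val + 1))))
  intro p hp
  have h := (FF_supp hp).1
  have h' : ∀ j : Fin (M + 1), 0 ≤ p.2 j ∧ p.2 j ≤ p.1 j ∧ p.1 j ≤ m (j.val + 1) := by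
    intro j
    have := h (j.val + 1) (Finset.mem_Icc.mpr ⟨by omega, by omega⟩)
    simpa only [ex_apply] using this
  refine ⟨⟨fun j => ?_, fun j => ?_⟩, ⟨fun j => ?_, fun j => ?_⟩⟩
  all_goals
    have := h' j
    simp only [Pi.zero_apply]
    omega

/-- The right hand side. -/
def SS (M : ℕ) (ν : ℕ → ℂ) (m : ℕ → ℤ) : ℂ := ∑' p : EE M, FF M ν m p

lemma SS_rec (M : ℕ) (ν : ℕ → ℂ)
    (h1 : ∀ i ∈ Finset.Icc 1 (M + 2), ∀ z : ℤ, ν i + ν (M + 2) ≠ z)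
    (h2 : ∀ i ∈ Finset.Icc 1 (M + 1), ∀ z : ℤ, ν i - ν (M + 2) ≠ z)
    (hq : ∀ m : ℕ → ℕ, 0 < ∑ i ∈ Finset.Icc 1 (M + 1), m i → qB (M + 1) m ν ≠ 0)
    (m : ℕ → ℤ) :
    qC (M + 2) (fun i => (m i : ℂ)) ν * SS M ν m =
      (∑ i ∈ Finset.Icc 1 (M + 1), SS M ν (m - un i)) + (1 / 2) * SS M ν (m - un (M + 2)) := by
  classical
  set F := FF M ν m with hF
  set B := (FF_fin M ν m).toFinset with hB
  let L : (EE M → ℂ) →ₗ[ℂ] ℂ := ∑ p ∈ B, F p • LinearMap.proj p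
  have hL : ∀ w, HasSum (fun p => w p * F p) (L w) := by
    intro w
    have : L w = ∑ p ∈ B, w p * F p := by
      simp [L, LinearMap.sum_apply, mul_comm]
    rw [this]
    apply hasSum_sum_of_ne_finset_zero
    intro p hp
    have : F p = 0 := by
      by_contra h
      exact hp (by simpa [hB] using h)
    rw [this, mul_zero]
  let l : EE M → ℕ → ℂ := fun p i => ((ex _ p.1 i : ℤ) : ℂ)
  let k : EE M → ℕ → ℂ := fun p i => ((ex _ p.2 i : ℤ) : ℂ)
  let mm : ℕ → ℂ := fun i => (m i : ℂ)
  let α : ℕ → EE M → ℂ := fun i p => (mm i - l p i) * (ν i + ν (M + 2) + mm i - l p (i - 1))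
  let αn : EE M → ℂ := fun p => (mm (M + 2) - k p (M + 1)) *
    (ν (M + 2) + ν (M + 2) + mm (M + 2) - l p (M + 1))
  let β : ℕ → EE M → ℂ := fun i p =>
    (mm i - l p i) * (ν (i + 1) + ν (M + 2) + mm (i + 1) - l p i)
  let γ : ℕ → EE M → ℂ := fun i p =>
    (l p i - k p i) * (ν i - ν (M + 2) + l p i - k p (i - 1))
  let δ : ℕ → EE M → ℂ := fun i p =>
    (l p i - k p i) * (ν (i + 1) - ν (M + 2) + l p (i + 1) - k p i)
  let δN : EE M → ℂ := fun p => (mm (M + 2) - k p (M + 1)) * (l p (M + 1) - k p (M + 1))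
  let Q : EE M → ℂ := fun p => qC (M + 1) (k p) ν
  have hconst : L (fun _ => qC (M + 2) mm ν) = qC (M + 2) mm ν * SS M ν m := by
    rw [← (hL _).tsum_eq, tsum_mul_left]; rfl
  have hα : ∀ i ∈ Finset.Icc 1 (M + 1), SS M ν (m - un i) = L (α i) := by
    intro i hi
    rw [← (hL _).tsum_eq, SS]
    congr 1
    funext p
    rw [hF, FF, FF, TT_m h1 hi]
    simp only [α, mm, l]
    ring
  have hαn : SS M ν (m - un (M + 2)) = L αn := by
    rw [← (hL _).tsum_eq, SS]
    congr 1
    funext p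
    rw [hF, FF, FF, TT_mn h1]
    simp only [αn, mm, l, k]
    ring
  have hβ : ∀ i ∈ Finset.Icc 1 (M + 1), L (β i) = L (γ i) := by
    intro i hi
    rw [← (hL _).tsum_eq, ← (hL _).tsum_eq, ← (sh1 M i).tsum_eq (fun p => γ i p * F p)]
    congr 1
    funext p
    have e1 : ex _ (sh1 M i p).1 = ex _ p.1 + un i := ex_add hi p.1
    have e2 : (sh1 M i p).2 = p.2 := add_zero p.2
    have := TT_l h1 h2 hi m (ex _ p.1) (ex _ p.2)
    simp only [β, γ, hF, FF, mm, l, k, e1, e2]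
    linear_combination CC (M + 1) ν (ex _ p.2) * this
  have mem : ∀ i ∈ Finset.Icc 1 M, i ∈ Finset.Icc 1 (M + 1) := by
    intro i hi
    have := Finset.mem_Icc.mp hi
    exact Finset.mem_Icc.mpr ⟨this.1, by omega⟩
  have memN : M + 1 ∈ Finset.Icc 1 (M + 1) := Finset.mem_Icc.mpr ⟨by omega, le_rfl⟩
  have hδ : ∀ i ∈ Finset.Icc 1 M,
      HasSum (fun p : EE M => CC (M + 1) ν (ex _ p.2 - un i) * TT M ν m (ex _ p.1) (ex _ p.2))
        (L (δ i)) := by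
    intro i hi
    rw [← (sh2 M i).hasSum_iff]
    convert hL (δ i) using 1
    funext p
    have e1 : ex _ (sh2 M i p).2 = ex _ p.2 + un i := ex_add (mem i hi) p.2
    have e2 : (sh2 M i p).1 = p.1 := add_zero p.1
    have := TT_k h2 hi m (ex _ p.1) (ex _ p.2)
    simp only [Function.comp_apply, δ, hF, FF, l, k, e1, e2, add_sub_cancel_right]
    rw [this]; ring
  have hδN : HasSum (fun p : EE M =>
      CC (M + 1) ν (ex _ p.2 - un (M + 1)) * TT M ν m (ex _ p.1) (ex _ p.2)) (L δN) := by
    rw [← (sh2 M (M + 1)).hasSum_iff]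
    convert hL δN using 1
    funext p
    have e1 : ex _ (sh2 M (M + 1) p).2 = ex _ p.2 + un (M + 1) := ex_add memN p.2
    have e2 : (sh2 M (M + 1) p).1 = p.1 := add_zero p.1
    have := TT_kN (M := M) (ν := ν) m (ex _ p.1) (ex _ p.2)
    simp only [Function.comp_apply, δN, hF, FF, l, k, mm, e1, e2, add_sub_cancel_right]
    rw [this]; ring
  have hQ : L Q = ∑ i ∈ Finset.Icc 1 M, L (δ i) + (1 / 2) * L δN := by
    refine (hL Q).unique ?_
    convert (hasSum_sum hδ).add (hδN.mul_left (1 / 2)) using 1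
    funext p
    have := CC_rec M ν hq (ex _ p.2)
    simp only [Q, hF, FF, k]
    rw [← mul_assoc, this, add_mul, Finset.sum_mul]; ring
  have hid : (fun _ => qC (M + 2) mm ν) - ∑ i ∈ Finset.Icc 1 (M + 1), α i - (1 / 2 : ℂ) • αn
      + ∑ i ∈ Finset.Icc 1 (M + 1), β i - ∑ i ∈ Finset.Icc 1 (M + 1), γ i
      + ∑ i ∈ Finset.Icc 1 M, δ i + (1 / 2 : ℂ) • δN - Q = 0 := by
    funext p
    have := poly_id M ν mm (l p) (k p) (by simp [l, ex_zero]) (by simp [k, ex_zero])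
    simp only [Pi.add_apply, Pi.sub_apply, Finset.sum_apply, Pi.smul_apply, smul_eq_mul,
      Pi.zero_apply]
    exact this
  have hfin := congrArg L hid
  simp only [map_add, map_sub, map_sum, map_smul, map_zero, smul_eq_mul] at hfin
  rw [hconst, hQ, Finset.sum_congr rfl hβ, ← Finset.sum_congr rfl hα, ← hαn] at hfin
  linear_combination hfin

lemma SS_neg {M : ℕ} {ν : ℕ → ℂ} {m : ℕ → ℤ} {i : ℕ} (hi : i ∈ Finset.Icc 1 (M + 2))
    (h : m i < 0) : SS M ν m = 0 := by
  have : FF M ν m = 0 := by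
    funext p
    by_contra hp
    obtain ⟨ha, hb⟩ := FF_supp hp
    have hi' := Finset.mem_Icc.mp hi
    by_cases hi2 : i = M + 2
    · subst hi2
      have := ha (M + 1) (Finset.mem_Icc.mpr ⟨by omega, le_rfl⟩)
      omega
    · have := ha i (Finset.mem_Icc.mpr ⟨by omega, by omega⟩)
      omega
  simp [SS, this]

lemma SS_zero (M : ℕ) (ν : ℕ → ℂ)
    (h1 : ∀ i ∈ Finset.Icc 1 (M + 2), ∀ z : ℤ, ν i + ν (M + 2) ≠ z)
    (h2 : ∀ i ∈ Finset.Icc 1 (M + 1), ∀ z : ℤ, ν i - ν (M + 2) ≠ z)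
    (m : ℕ → ℤ) (hm : ∀ i ∈ Finset.Icc 1 (M + 2), m i = 0) : SS M ν m = 1 := by
  have ez : ex (M + 1) 0 = 0 := by funext i; simp [ex]
  rw [SS, tsum_eq_single (0 : EE M)]
  · have hc : CC (M + 1) ν 0 = 1 := by
      simp [CC, cB, cAux]
    simp only [FF, Prod.fst_zero, Prod.snd_zero, ez, hc, one_mul]
    unfold TT
    rw [Finset.prod_eq_one, Finset.prod_eq_one, Finset.prod_eq_one, Finset.prod_eq_one,
      hm (M + 2) (Finset.mem_Icc.mpr ⟨by omega, le_rfl⟩)]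
    · simp [rf_zero]
    · intro i hi
      simpa using rp_zero _ (h2 i hi)
    · intro i hi
      rw [hm i hi]
      simpa using rp_zero _ (h1 i hi)
    · intro i hi; simp [rf_zero]
    · intro i hi
      have := Finset.mem_Icc.mp hi
      rw [hm i (Finset.mem_Icc.mpr ⟨by omega, by omega⟩)]
      simp [rf_zero]
  · intro p hp
    by_contra h
    obtain ⟨ha, -⟩ := FF_supp h
    apply hp
    have h' : ∀ j : Fin (M + 1), 0 ≤ p.2 j ∧ p.2 j ≤ p.1 j ∧ p.1 j ≤ 0 := by
      intro j
      have := ha (j.val + 1) (Finset.mem_Icc.mpr ⟨by omega, by omega⟩)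
      rw [hm (j.val + 1) (Finset.mem_Icc.mpr ⟨by omega, by omega⟩)] at this
      simpa only [ex_apply] using this
    ext j
    · have := h' j; simp only [Prod.fst_zero, Pi.zero_apply]; omega
    · have := h' j; simp only [Prod.snd_zero, Pi.zero_apply]; omega

lemma SS_dec (M : ℕ) (ν : ℕ → ℂ) (m : ℕ → ℕ) {i : ℕ} (hi : i ∈ Finset.Icc 1 (M + 2)) :
    SS M ν ((fun j => (m j : ℤ)) - un i) =
      if m i = 0 then 0 else SS M ν (fun j => (dec m i j : ℤ)) := by
  split_ifs with h
  · apply SS_neg hi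
    rw [Pi.sub_apply, un_self, h]; norm_num
  · congr 1
    funext j
    by_cases hj : j = i
    · subst hj; simp only [Pi.sub_apply, un_self, dec, Function.update_self]; omega
    · simp [un_ne hj, dec, hj]

lemma cAux_eq (M : ℕ) (ν : ℕ → ℂ)
    (h1 : ∀ i ∈ Finset.Icc 1 (M + 2), ∀ z : ℤ, ν i + ν (M + 2) ≠ z)
    (h2 : ∀ i ∈ Finset.Icc 1 (M + 1), ∀ z : ℤ, ν i - ν (M + 2) ≠ z)
    (hq : ∀ m : ℕ → ℕ, 0 < ∑ i ∈ Finset.Icc 1 (M + 1), m i → qB (M + 1) m ν ≠ 0)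
    (hq2 : ∀ m : ℕ → ℕ, 0 < ∑ i ∈ Finset.Icc 1 (M + 2), m i → qB (M + 2) m ν ≠ 0)
    (d : ℕ) : ∀ m : ℕ → ℕ, ∑ i ∈ Finset.Icc 1 (M + 2), m i = d →
      cAux (M + 2) ν d m = SS M ν (fun j => (m j : ℤ)) := by
  induction d with
  | zero =>
    intro m hm
    rw [cAux, SS_zero M ν h1 h2]
    intro i hi
    have := (Finset.sum_eq_zero_iff.mp hm) i hi
    simp [this]
  | succ d ih =>
    intro m hm
    have hq' := hq2 m (by omega)
    have key : ∀ i ∈ Finset.Icc 1 (M + 2), (if m i = 0 then 0 else cAux (M + 2) ν d (dec m i)) =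
        SS M ν ((fun j => (m j : ℤ)) - un i) := by
      intro i hi
      rw [SS_dec M ν m hi]
      split_ifs with h
      · rfl
      · apply ih
        have := dec_sum hi h
        omega
    have memN : M + 2 ∈ Finset.Icc 1 (M + 2) := Finset.mem_Icc.mpr ⟨by omega, le_rfl⟩
    rw [cAux, div_eq_iff hq', key _ memN]
    have hr := SS_rec M ν h1 h2 hq (fun j => (m j : ℤ))
    have e : qC (M + 2) (fun i => (((m i : ℕ) : ℤ) : ℂ)) ν = qB (M + 2) m ν := by
      simp [qC, qB]
    rw [e] at hr
    rw [mul_comm (SS M ν _), hr]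
    congr 1
    apply Finset.sum_congr rfl
    intro i hi
    have := Finset.mem_Icc.mp hi
    exact key i (Finset.mem_Icc.mpr ⟨by omega, by omega⟩)

lemma SS_nat (M : ℕ) (ν : ℕ → ℂ) (m : ℕ → ℕ) :
    SS M ν (fun j => (m j : ℤ)) =
        ∑' lk : (Fin (M + 1) → ℕ) × (Fin (M + 1) → ℕ),
          cB (M + 1) ν (extN (M + 1) lk.2) /
            ((∏ i ∈ Finset.Icc 1 (M + 1), zfact ((m i : ℤ) - (extN (M + 1) lk.1 i : ℤ))) *
              zfact ((m (M + 2) : ℤ) - (extN (M + 1) lk.2 (M + 1) : ℤ)) *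
              (∏ i ∈ Finset.Icc 1 (M + 1),
                zfact ((extN (M + 1) lk.1 i : ℤ) - (extN (M + 1) lk.2 i : ℤ))) *
              (∏ i ∈ Finset.Icc 1 (M + 2),
                poch (ν i + ν (M + 2) + 1) ((m i : ℤ) - (extN (M + 1) lk.1 (i - 1) : ℤ))) *
              ∏ i ∈ Finset.Icc 1 (M + 1),
                poch (ν i - ν (M + 2) + 1)
                  ((extN (M + 1) lk.1 i : ℤ) - (extN (M + 1) lk.2 (i - 1) : ℤ))) := by
  let g : (Fin (M + 1) → ℕ) × (Fin (M + 1) → ℕ) → EE M :=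
    fun p => (fun j => (p.1 j : ℤ), fun j => (p.2 j : ℤ))
  have hg : Function.Injective g := by
    intro p q h
    have h1 := congrArg Prod.fst h
    have h2 := congrArg Prod.snd h
    ext j
    · have := congrFun h1 j; simpa [g] using this
    · have := congrFun h2 j; simpa [g] using this
  have hs : Function.support (FF M ν (fun j => (m j : ℤ))) ⊆ Set.range g := by
    intro p hp
    obtain ⟨ha, -⟩ := FF_supp hp
    have h' : ∀ j : Fin (M + 1), 0 ≤ p.2 j ∧ p.2 j ≤ p.1 j := by
      intro j
      have := ha (j.val + 1) (Finset.mem_Icc.mpr ⟨by omega, by omega⟩)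
      simp only [ex_apply] at this
      exact ⟨this.1, this.2.1⟩
    refine ⟨(fun j => (p.1 j).toNat, fun j => (p.2 j).toNat), ?_⟩
    ext j
    · have := h' j; simp only [g]; omega
    · have := h' j; simp only [g]; omega
  rw [SS, ← hg.tsum_eq hs]
  congr 1
  funext p
  have ee : ∀ t : Fin (M + 1) → ℕ, ex (M + 1) (fun j => (t j : ℤ)) =
      fun i => (extN (M + 1) t i : ℤ) := by
    intro t
    funext i
    unfold ex extN
    split_ifs <;> simp
  have hc : CC (M + 1) ν (fun i => (extN (M + 1) p.2 i : ℤ)) =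
      cB (M + 1) ν (extN (M + 1) p.2) := by
    rw [CC, if_pos (fun i _ => Int.natCast_nonneg _)]
    simp
  simp only [FF, g, ee, hc, TT, rf, rp, div_eq_mul_inv, mul_inv, Finset.prod_inv_distrib]

lemma part_one (μ : ℕ → ℂ) (h : ∀ m : ℕ, 1 ≤ m → qB 1 (fun _ => m) μ ≠ 0) (m : ℕ) :
    ∀ f : ℕ → ℕ, f 1 = m → cAux 1 μ m f =
        1 / ((Nat.factorial m : ℂ) * poch (2 * μ 1 + 1) (m : ℤ)) := by
  have hne : ∀ m : ℕ, 1 ≤ m → 2 * μ 1 + m ≠ 0 := by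
    intro m hm h0
    apply h m hm
    simp only [qB]
    simp
    linear_combination (m : ℂ) / 2 * h0
  have hG : Complex.Gamma (2 * μ 1 + 1) ≠ 0 := by
    apply Complex.Gamma_ne_zero
    intro k hk
    apply hne (k + 1) (by omega)
    push_cast
    linear_combination hk
  induction m with
  | zero =>
    intro f _
    simp [cAux, poch, hG]
  | succ m ih =>
    intro f hf
    have hd : dec f 1 1 = m := by simp [dec, hf]
    have hq : qB 1 f μ = ((m : ℂ) + 1) * (2 * μ 1 + (m + 1 : ℕ)) / 2 := by
      simp [qB, hf]; ring
    have h3 := hne (m + 1) (by omega)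
    have h4 : (m : ℂ) + 1 ≠ 0 := by exact_mod_cast Nat.succ_ne_zero m
    have hp : poch (2 * μ 1 + 1) ((m + 1 : ℕ) : ℤ) =
        (2 * μ 1 + (m + 1 : ℕ)) * poch (2 * μ 1 + 1) (m : ℤ) := by
      unfold poch
      have e : 2 * μ 1 + 1 + (((m + 1 : ℕ) : ℤ) : ℂ) = (2 * μ 1 + (m + 1 : ℕ)) + 1 := by
        push_cast; ring
      have e' : 2 * μ 1 + 1 + (((m : ℕ) : ℤ) : ℂ) = 2 * μ 1 + (m + 1 : ℕ) := by
        push_cast; ring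
      rw [e, e', Complex.Gamma_add_one _ h3, mul_div_assoc]
    rw [cAux, ih _ hd, hq, hp, if_neg (by omega), Nat.factorial_succ]
    simp only [Nat.sub_self, Finset.Icc_eq_empty (show ¬ (1 ≤ 0) by omega), Finset.sum_empty,
      zero_add]
    simp only [div_eq_mul_inv, mul_inv, inv_inv, Nat.cast_mul]
    push_cast
    ring

lemma wAct_one (n : ℕ) (ν : ℕ → ℂ) : wAct n (1, fun _ => false) ν = ν := by
  funext i
  unfold wAct
  by_cases h : 1 ≤ i ∧ i ≤ n
  · have e : i - 1 + 1 = i := by omega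
    simp [h, e]
  · simp [h]

lemma reg_plus {M : ℕ} {ν : ℕ → ℂ} (hreg : Regular (M + 2) ν) :
    ∀ i ∈ Finset.Icc 1 (M + 2), ∀ z : ℤ, ν i + ν (M + 2) ≠ z := by
  intro i hi z hz
  have hi' := Finset.mem_Icc.mp hi
  let a : Fin (M + 2) := ⟨i - 1, by omega⟩
  let b : Fin (M + 2) := ⟨M + 1, by omega⟩
  refine hreg.2 (1, fun _ => false) (Equiv.swap a b, fun j => decide (j = a ∨ j = b)) ?_ ?_
  · intro h
    have := congrFun (congrArg Prod.snd h) a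
    simp at this
  · intro j hj
    have hj' := Finset.mem_Icc.mp hj
    rw [wAct_one]
    have h3 : 1 ≤ j ∧ j ≤ M + 2 := hj'
    by_cases hja : j = i
    · subst hja
      refine ⟨z, ?_⟩
      have : (⟨j - 1, by omega⟩ : Fin (M + 2)) = a := rfl
      simp only [wAct, dif_pos h3, this, Equiv.swap_apply_left]
      simpa [b] using hz
    · by_cases hjb : j = M + 2
      · subst hjb
        refine ⟨z, ?_⟩
        have : (⟨M + 2 - 1, by omega⟩ : Fin (M + 2)) = b := rfl
        simp only [wAct, dif_pos h3, this, Equiv.swap_apply_right]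
        have e : i - 1 + 1 = i := by omega
        simp [a, e]
        rw [← hz]; ring
      · refine ⟨0, ?_⟩
        have n1 : (⟨j - 1, by omega⟩ : Fin (M + 2)) ≠ a := by
          intro h; have := congrArg Fin.val h; simp [a] at this; omega
        have n2 : (⟨j - 1, by omega⟩ : Fin (M + 2)) ≠ b := by
          intro h; have := congrArg Fin.val h; simp [b] at this; omega
        have e : j - 1 + 1 = j := by omega
        simp only [wAct, dif_pos h3, Equiv.swap_apply_of_ne_of_ne n1 n2]
        simp [n1, n2, e]

lemma reg_minus {M : ℕ} {ν : ℕ → ℂ} (hreg : Regular (M + 2) ν) :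
    ∀ i ∈ Finset.Icc 1 (M + 1), ∀ z : ℤ, ν i - ν (M + 2) ≠ z := by
  intro i hi z hz
  have hi' := Finset.mem_Icc.mp hi
  let a : Fin (M + 2) := ⟨i - 1, by omega⟩
  let b : Fin (M + 2) := ⟨M + 1, by omega⟩
  have hab : a ≠ b := by
    intro h; have := congrArg Fin.val h; simp [a, b] at this; omega
  refine hreg.2 (1, fun _ => false) (Equiv.swap a b, fun _ => false) ?_ ?_
  · intro h
    have := congrArg (fun f : Equiv.Perm (Fin (M + 2)) => f a) (congrArg Prod.fst h)
    simp at this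
    exact hab this
  · intro j hj
    have hj' := Finset.mem_Icc.mp hj
    rw [wAct_one]
    have h3 : 1 ≤ j ∧ j ≤ M + 2 := hj'
    by_cases hja : j = i
    · subst hja
      refine ⟨z, ?_⟩
      have : (⟨j - 1, by omega⟩ : Fin (M + 2)) = a := rfl
      simp only [wAct, dif_pos h3, this, Equiv.swap_apply_left]
      simpa [b] using hz
    · by_cases hjb : j = M + 2
      · subst hjb
        refine ⟨-z, ?_⟩
        have : (⟨M + 2 - 1, by omega⟩ : Fin (M + 2)) = b := rfl
        simp only [wAct, dif_pos h3, this, Equiv.swap_apply_right]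
        have e : i - 1 + 1 = i := by omega
        simp [a, e]
        rw [← hz]; ring
      · refine ⟨0, ?_⟩
        have n1 : (⟨j - 1, by omega⟩ : Fin (M + 2)) ≠ a := by
          intro h; have := congrArg Fin.val h; simp [a] at this; omega
        have n2 : (⟨j - 1, by omega⟩ : Fin (M + 2)) ≠ b := by
          intro h; have := congrArg Fin.val h; simp [b] at this; omega
        have e : j - 1 + 1 = j := by omega
        simp only [wAct, dif_pos h3, Equiv.swap_apply_of_ne_of_ne n1 n2]
        simp [e]

lemma reg_q {M : ℕ} {ν : ℕ → ℂ} (hreg : Regular (M + 2) ν) (m : ℕ → ℕ)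
    (hm : 0 < ∑ i ∈ Finset.Icc 1 (M + 2), m i) : qB (M + 2) m ν ≠ 0 := by
  have := hreg.1 (1, fun _ => false) m hm
  rwa [wAct_one] at this

lemma reg_q' {M : ℕ} {ν : ℕ → ℂ} (hreg : Regular (M + 2) ν) (m : ℕ → ℕ)
    (hm : 0 < ∑ i ∈ Finset.Icc 1 (M + 1), m i) : qB (M + 1) m ν ≠ 0 := by
  let m' : ℕ → ℕ := fun i => if i = M + 2 then m (M + 1) else m i
  have hm' : ∀ i, i ≤ M + 1 → m' i = m i := by
    intro i hi
    simp [m', show i ≠ M + 2 by omega]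
  have hl : m' (M + 2) = m (M + 1) := by simp [m']
  have := reg_q hreg m' (by
    rw [Finset.sum_Icc_succ_top (by omega)]
    rw [Finset.sum_congr rfl (fun i hi => hm' i (Finset.mem_Icc.mp hi).2)]
    exact Nat.add_pos_left hm _)
  have e : qB (M + 2) m' ν = qB (M + 1) m ν := by
    unfold qB
    simp only [show M + 2 - 1 = M + 1 by omega, Nat.add_sub_cancel,
      Finset.sum_Icc_succ_top (show 1 ≤ M + 1 by omega)]
    rw [hl, hm' (M + 1) le_rfl]
    have s1 : ∑ i ∈ Finset.Icc 1 M, (m' i : ℂ) ^ 2 = ∑ i ∈ Finset.Icc 1 M, (m i : ℂ) ^ 2 :=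
      Finset.sum_congr rfl (fun i hi => by
        have := Finset.mem_Icc.mp hi
        rw [hm' i (by omega)])
    have s2 : ∑ i ∈ Finset.Icc 1 M, (m' i : ℂ) * m' (i + 1) =
        ∑ i ∈ Finset.Icc 1 M, (m i : ℂ) * m (i + 1) :=
      Finset.sum_congr rfl (fun i hi => by
        have := Finset.mem_Icc.mp hi
        rw [hm' i (by omega), hm' (i + 1) (by omega)])
    have s3 : ∑ i ∈ Finset.Icc 1 M, (ν i - ν (i + 1)) * (m' i : ℂ) =
        ∑ i ∈ Finset.Icc 1 M, (ν i - ν (i + 1)) * (m i : ℂ) :=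
      Finset.sum_congr rfl (fun i hi => by
        have := Finset.mem_Icc.mp hi
        rw [hm' i (by omega)])
    rw [s1, s2, s3]
    ring
  rwa [e] at this

/-- explicit formula for the coefficients of the fundamental Whittaker
functions: the `n = 1` case and the recursive formula. -/
theorem stmt1 (n : ℕ) (hn : 2 ≤ n) (ν : ℕ → ℂ) (hreg : Regular n ν) :
    (∀ μ : ℕ → ℂ, (∀ m : ℕ, 1 ≤ m → qB 1 (fun _ => m) μ ≠ 0) →
      ∀ m : ℕ, cB 1 μ (fun _ => m) =
        1 / ((Nat.factorial m : ℂ) * poch (2 * μ 1 + 1) (m : ℤ))) ∧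
    ∀ m : ℕ → ℕ,
      cB n ν m =
        ∑' lk : (Fin (n - 1) → ℕ) × (Fin (n - 1) → ℕ),
          cB (n - 1) ν (extN (n - 1) lk.2) /
            ((∏ i ∈ Finset.Icc 1 (n - 1), zfact ((m i : ℤ) - (extN (n - 1) lk.1 i : ℤ))) *
              zfact ((m n : ℤ) - (extN (n - 1) lk.2 (n - 1) : ℤ)) *
              (∏ i ∈ Finset.Icc 1 (n - 1),
                zfact ((extN (n - 1) lk.1 i : ℤ) - (extN (n - 1) lk.2 i : ℤ))) *
              (∏ i ∈ Finset.Icc 1 n,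
                poch (ν i + ν n + 1) ((m i : ℤ) - (extN (n - 1) lk.1 (i - 1) : ℤ))) *
              ∏ i ∈ Finset.Icc 1 (n - 1),
                poch (ν i - ν n + 1)
                  ((extN (n - 1) lk.1 i : ℤ) - (extN (n - 1) lk.2 (i - 1) : ℤ))) := by
  obtain ⟨M, rfl⟩ : ∃ M, n = M + 2 := ⟨n - 2, by omega⟩
  refine ⟨?_, ?_⟩
  · intro μ hμ m
    have := part_one μ hμ m (fun _ => m) rfl
    rw [cB]
    simpa using this
  · intro m
    rw [cB, cAux_eq M ν (reg_plus hreg) (reg_minus hreg) (reg_q' hreg) (reg_q hreg) _ m rfl]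
    exact SS_nat M ν m

end SO
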